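/- arXiv:1510.06951 — 2 statements merged into one kernel-verified Lean document; each statement's English description precedes it below -/
import Mathlib

section
/- Let κ > 0 and σ > 0, and let f(x) = Z^{−1}·(1 + κ·(x/σ)²)^{−(1+κ)/(2κ)} on ℝ be the coupled Gaussian density, where Z = √π·Γ(1/(2κ))·σ/(√κ·Γ((1+κ)/(2κ))). With m = 2κ/(1+κ), the coupled entropy of f has the closed form S^C_{2,κ}(f) = (1/(2κ))·( ( ∫_{−∞}^∞ f(x)^{1+m} dx )^{−1} − 1 ) = ( −κ + (1+κ)·(κ·π^κ)^{1/(1+κ)}·( σ·Γ(1/(2κ))/Γ((1+κ)/(2κ)) )^{2κ/(1+κ)} ) / (2κ²). -/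
open MeasureTheory Real

/-- The total mass of the generalized Cauchy (Student) kernel `(1 + x²)^(-q)`. -/
theorem integral_one_add_sq_rpow_neg {q : ℝ} (hq : 1 / 2 < q) :
    ∫ x : ℝ, (1 + x ^ 2) ^ (-q) = √π * Gamma (q - 1 / 2) / Gamma q := by
  have hq0 : 0 < q := by linarith
  have hG : 0 < Gamma q := Gamma_pos_of_pos hq0
  have hG' : 0 < Gamma (q - 1 / 2) := Gamma_pos_of_pos (by linarith)
  have inner_t (x : ℝ) :
      ∫⁻ t in Set.Ioi (0 : ℝ), ENNReal.ofReal (t ^ (q - 1) * rexp (-((1 + x ^ 2) * t))) =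
        ENNReal.ofReal ((1 + x ^ 2) ^ (-q) * Gamma q) := by
    have hx : 0 < 1 + x ^ 2 := by positivity
    have h := integral_rpow_mul_exp_neg_mul_Ioi hq0 hx
    rw [← ofReal_integral_eq_lintegral_ofReal, h, one_div, inv_rpow hx.le, rpow_neg hx.le]
    · refine Integrable.of_integral_ne_zero ?_
      rw [h]
      positivity
    · filter_upwards [ae_restrict_mem measurableSet_Ioi] with t (ht : 0 < t)
      positivity
  have inner_x (t : ℝ) (ht : t ∈ Set.Ioi (0 : ℝ)) :
      ∫⁻ x : ℝ, ENNReal.ofReal (t ^ (q - 1) * rexp (-((1 + x ^ 2) * t))) =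
        ENNReal.ofReal (√π * (t ^ (q - 1 / 2 - 1) * rexp (-(1 * t)))) := by
    replace ht : 0 < t := ht
    have hsplit : (fun x : ℝ => t ^ (q - 1) * rexp (-((1 + x ^ 2) * t))) =
        fun x => t ^ (q - 1) * rexp (-t) * rexp (-t * x ^ 2) := by
      funext x
      rw [mul_assoc, ← Real.exp_add]
      ring_nf
    rw [← ofReal_integral_eq_lintegral_ofReal, hsplit, integral_const_mul, integral_gaussian,
      sqrt_div pi_pos.le, show q - 1 / 2 - 1 = q - 1 - 1 / 2 by ring, rpow_sub ht (q - 1),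
      ← sqrt_eq_rpow, one_mul]
    · congr 1
      ring
    · rw [hsplit]
      exact (integrable_exp_neg_mul_sq ht).const_mul _
    · exact Filter.Eventually.of_forall fun x => by positivity
  have hmass : ∫⁻ x : ℝ, ENNReal.ofReal ((1 + x ^ 2) ^ (-q) * Gamma q) =
      ENNReal.ofReal (√π * Gamma (q - 1 / 2)) := by
    have h := integral_rpow_mul_exp_neg_mul_Ioi (a := q - 1 / 2) (by linarith) one_pos
    simp_rw [← inner_t]
    rw [lintegral_lintegral_swap (by fun_prop), setLIntegral_congr_fun measurableSet_Ioi inner_x,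
      ← ofReal_integral_eq_lintegral_ofReal, integral_const_mul, h]
    · simp
    · refine Integrable.const_mul (Integrable.of_integral_ne_zero ?_) _
      rw [h]
      positivity
    · filter_upwards [ae_restrict_mem measurableSet_Ioi] with t (ht : 0 < t)
      positivity
  have hint : ∫ x : ℝ, (1 + x ^ 2) ^ (-q) * Gamma q = √π * Gamma (q - 1 / 2) := by
    rw [integral_eq_lintegral_of_nonneg_ae
      (Filter.Eventually.of_forall fun x => by positivity)
      (Measurable.aestronglyMeasurable (by fun_prop)), hmass, ENNReal.toReal_ofReal (by positivity)]
  rw [eq_div_iff hG.ne', ← integral_mul_const, hint]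

/-- The total mass of the rescaled kernel `(1 + κ (x/σ)²)^(-q)`. -/
theorem integral_one_add_mul_div_sq_rpow_neg {κ σ q : ℝ} (hκ : 0 < κ) (hσ : 0 < σ)
    (hq : 1 / 2 < q) :
    ∫ x : ℝ, (1 + κ * (x / σ) ^ 2) ^ (-q) =
      σ / √κ * (√π * Gamma (q - 1 / 2) / Gamma q) := by
  have h (x : ℝ) : κ * (x / σ) ^ 2 = (x / (σ / √κ)) ^ 2 := by
    simp only [div_pow, sq_sqrt hκ.le]
    field_simp
  simp_rw [h]
  rw [Measure.integral_comp_div (fun x : ℝ => (1 + x ^ 2) ^ (-q)),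
    integral_one_add_sq_rpow_neg hq, abs_of_pos (by positivity), smul_eq_mul]

/-- The coupled entropy of the coupled Gaussian density has the closed form
`(1/(2κ))·((∫ f^{1+m})⁻¹ − 1)
  = (−κ + (1+κ)·(κ·π^κ)^{1/(1+κ)}·(σ·Γ(1/(2κ))/Γ((1+κ)/(2κ)))^{2κ/(1+κ)})/(2κ²)`. -/
theorem coupledEntropy_coupledGaussian (κ σ : ℝ) (hκ : 0 < κ) (hσ : 0 < σ)
    (m Z : ℝ) (hm : m = 2 * κ / (1 + κ))
    (hZ : Z = Real.sqrt Real.pi * Real.Gamma (1 / (2 * κ)) * σ /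
        (Real.sqrt κ * Real.Gamma ((1 + κ) / (2 * κ))))
    (f : ℝ → ℝ)
    (hf : f = fun x => Z⁻¹ * (1 + κ * (x / σ) ^ 2) ^ (-(1 + κ) / (2 * κ))) :
    (1 / (2 * κ)) * ((∫ x, f x ^ (1 + m))⁻¹ - 1) =
      (-κ + (1 + κ) * (κ * Real.pi ^ κ) ^ (1 / (1 + κ)) *
          (σ * Real.Gamma (1 / (2 * κ)) / Real.Gamma ((1 + κ) / (2 * κ))) ^
            (2 * κ / (1 + κ))) / (2 * κ ^ 2) := by
  have hΓs : 0 < Gamma (1 / (2 * κ)) := Gamma_pos_of_pos (by positivity)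
  have hp : 0 < (1 + κ) / (2 * κ) := by positivity
  have hΓp : 0 < Gamma ((1 + κ) / (2 * κ)) := Gamma_pos_of_pos hp
  have hZ0 : 0 < Z := by
    rw [hZ]
    positivity
  have hpow (x : ℝ) : f x ^ (1 + m) =
      Z⁻¹ ^ (1 + m) * (1 + κ * (x / σ) ^ 2) ^ (-((1 + κ) / (2 * κ) + 1)) := by
    rw [hf, mul_rpow (by positivity) (by positivity), ← rpow_mul (by positivity), hm]
    congr 2
    field_simp
  have hmass : ∫ x : ℝ, (1 + κ * (x / σ) ^ 2) ^ (-((1 + κ) / (2 * κ) + 1)) = Z / (1 + κ) := by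
    rw [integral_one_add_mul_div_sq_rpow_neg hκ hσ (by linarith),
      show (1 + κ) / (2 * κ) + 1 - 1 / 2 = 1 / (2 * κ) + 1 by field_simp; ring,
      Gamma_add_one hp.ne', Gamma_add_one (by positivity), hZ]
    field_simp
  have hint : (∫ x, f x ^ (1 + m))⁻¹ = (1 + κ) * Z ^ m := by
    simp_rw [hpow]
    rw [integral_const_mul, hmass, inv_rpow hZ0.le, rpow_add hZ0, rpow_one]
    field_simp
  have hZm : Z ^ m = (κ * π ^ κ) ^ (1 / (1 + κ)) / κ *
      (σ * Gamma (1 / (2 * κ)) / Gamma ((1 + κ) / (2 * κ))) ^ (2 * κ / (1 + κ)) := by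
    have hfactor : Z = √(π / κ) *
        (σ * Gamma (1 / (2 * κ)) / Gamma ((1 + κ) / (2 * κ))) := by
      rw [hZ, sqrt_div pi_pos.le]
      field_simp
    have hconst : √(π / κ) ^ m = (κ * π ^ κ) ^ (1 / (1 + κ)) / κ := by
      rw [sqrt_eq_rpow, ← rpow_mul (by positivity), div_rpow pi_pos.le hκ.le,
        mul_rpow hκ.le (by positivity), ← rpow_mul pi_pos.le,
        show 1 / 2 * m = κ * (1 / (1 + κ)) by rw [hm]; field_simp,
        show κ * (1 / (1 + κ)) = 1 - 1 / (1 + κ) by field_simp; ring, rpow_sub hκ, rpow_one]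
      field_simp
    rw [hfactor, mul_rpow (by positivity) (by positivity), hconst, hm]
  rw [hint, hZm]
  field_simp
  ring
end

section
/- Let κ > 0 and σ > 0, and let f(x) = (1/σ)·(1 + κ·x/σ)^{−(1+κ)/κ} for x ≥ 0 be the coupled exponential density. With m = κ/(1+κ), the Tsallis entropy of f has the closed form S^T_{1,κ}(f) = −(1+κ)·∫_0^∞ f(x)^{1+m}·ln_{−1,κ}(f(x)) dx = ( 1 + κ − σ^{−κ/(1+κ)} )/κ; in particular, when σ = 1 the Tsallis entropy equals 1 for every κ > 0. -/
open MeasureTheory Real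

/-- The antiderivative of a power of an increasing affine function, on the positive half-line. -/
theorem hasDerivAt_one_add_mul_rpow_neg {a c x : ℝ} (ha : 0 < a) (hc : 0 < c) (hx : 0 ≤ x) :
    HasDerivAt (fun x : ℝ => -(1 / (c * a)) * (1 + c * x) ^ (-a))
      ((1 + c * x) ^ (-a - 1)) x := by
  have hpos : 0 < 1 + c * x := by positivity
  have h := (((hasDerivAt_id x).const_mul c).const_add 1).rpow_const (p := -a) (Or.inl hpos.ne')
  convert! h.const_mul (-(1 / (c * a))) using 1
  simp only [id]
  field_simp

theorem tendsto_one_add_mul_rpow_neg {a c : ℝ} (ha : 0 < a) (hc : 0 < c) :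
    Filter.Tendsto (fun x : ℝ => -(1 / (c * a)) * (1 + c * x) ^ (-a)) Filter.atTop (nhds 0) := by
  have h := (tendsto_rpow_neg_atTop ha).comp
    (Filter.tendsto_atTop_add_const_left _ 1 (Filter.tendsto_id.const_mul_atTop hc))
  simpa using h.const_mul (-(1 / (c * a)))

theorem integrableOn_Ioi_one_add_mul_rpow {a c : ℝ} (ha : 0 < a) (hc : 0 < c) :
    IntegrableOn (fun x : ℝ => (1 + c * x) ^ (-a - 1)) (Set.Ioi 0) :=
  integrableOn_Ioi_deriv_of_nonneg' (fun _ hx => hasDerivAt_one_add_mul_rpow_neg ha hc hx)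
    (fun x hx => by have : 0 < x := hx; positivity) (tendsto_one_add_mul_rpow_neg ha hc)

theorem integral_Ioi_one_add_mul_rpow {a c : ℝ} (ha : 0 < a) (hc : 0 < c) :
    ∫ x in Set.Ioi (0 : ℝ), (1 + c * x) ^ (-a - 1) = 1 / (c * a) := by
  rw [integral_Ioi_of_hasDerivAt_of_tendsto'
    (fun _ hx => hasDerivAt_one_add_mul_rpow_neg ha hc hx)
    (integrableOn_Ioi_one_add_mul_rpow ha hc) (tendsto_one_add_mul_rpow_neg ha hc)]
  simp

/-- The Tsallis entropy of the coupled exponential density has the closed form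
`−(1+κ)·∫_0^∞ f^{1+m}·ln_{−1,κ}(f) = (1 + κ − σ^{−κ/(1+κ)})/κ`; in particular it equals
`1` when `σ = 1`. -/
theorem tsallisEntropy_coupledExponential (κ σ : ℝ) (hκ : 0 < κ) (hσ : 0 < σ)
    (m : ℝ) (hm : m = κ / (1 + κ)) (f : ℝ → ℝ)
    (hf : f = fun x => (1 / σ) * (1 + κ * x / σ) ^ (-(1 + κ) / κ)) :
    -(1 + κ) *
          (∫ x in Set.Ici (0 : ℝ),
            f x ^ (1 + m) * ((-1 / κ) * (f x ^ (-(κ / (1 + κ))) - 1))) =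
        (1 + κ - σ ^ (-(κ / (1 + κ)))) / κ ∧
      (σ = 1 →
        -(1 + κ) *
            (∫ x in Set.Ici (0 : ℝ),
              f x ^ (1 + m) * ((-1 / κ) * (f x ^ (-(κ / (1 + κ))) - 1))) = 1) := by
  have key : -(1 + κ) *
      (∫ x in Set.Ici (0 : ℝ),
        f x ^ (1 + m) * ((-1 / κ) * (f x ^ (-(κ / (1 + κ))) - 1))) =
      (1 + κ - σ ^ (-(κ / (1 + κ)))) / κ := by
    have hc : 0 < κ / σ := by positivity
    have ha : 0 < 1 / κ := by positivity
    have hb : 0 < 1 / κ + 1 := by positivity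
    have hpt : ∀ x ∈ Set.Ioi (0 : ℝ),
        f x ^ (1 + m) * ((-1 / κ) * (f x ^ (-(κ / (1 + κ))) - 1)) =
          (-1 / (κ * σ)) * (1 + κ / σ * x) ^ (-(1 / κ) - 1) -
            (-1 / (κ * σ) * σ ^ (-m)) * (1 + κ / σ * x) ^ (-(1 / κ + 1) - 1) := by
      intro x hx
      have hx : 0 < x := hx
      have hu : 0 < 1 + κ / σ * x := by positivity
      have hfx : f x = σ⁻¹ * (1 + κ / σ * x) ^ (-(1 / κ) - 1) := by
        rw [hf]
        have h1 : κ * x / σ = κ / σ * x := by ring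
        have h2 : -(1 + κ) / κ = -(1 / κ) - 1 := by field_simp; ring
        simp only [h1, h2, one_div]
      have hfpos : 0 < f x := by rw [hfx]; positivity
      have hfm : f x ^ m = σ ^ (-m) * (1 + κ / σ * x) ^ (-1 : ℝ) := by
        rw [hfx, mul_rpow (by positivity) (by positivity), inv_rpow hσ.le, ← rpow_neg hσ.le,
          ← rpow_mul hu.le]
        congr 2
        rw [hm]
        field_simp
        ring
      have hexp : (1 + κ / σ * x) ^ (-(1 / κ + 1) - 1) =
          (1 + κ / σ * x) ^ (-(1 / κ) - 1) * (1 + κ / σ * x) ^ (-1 : ℝ) := by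
        rw [← rpow_add hu]
        congr 1
        ring
      have hcancel : f x ^ m * f x ^ (-m) = 1 := by
        rw [← rpow_add hfpos, add_neg_cancel, rpow_zero]
      calc f x ^ (1 + m) * ((-1 / κ) * (f x ^ (-(κ / (1 + κ))) - 1))
          = -1 / κ * (f x * (f x ^ m * f x ^ (-m)) - f x * f x ^ m) := by
            rw [← hm, rpow_add hfpos, rpow_one]; ring
        _ = _ := by
            rw [hcancel, hfm, hfx, hexp]
            field_simp
            ring
    rw [integral_Ici_eq_integral_Ioi, setIntegral_congr_fun measurableSet_Ioi hpt,
      integral_sub ((integrableOn_Ioi_one_add_mul_rpow ha hc).const_mul _)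
        ((integrableOn_Ioi_one_add_mul_rpow hb hc).const_mul _),
      integral_const_mul, integral_const_mul, integral_Ioi_one_add_mul_rpow ha hc,
      integral_Ioi_one_add_mul_rpow hb hc, ← hm]
    field_simp
    ring
  refine ⟨key, fun h => ?_⟩
  rw [key, h, one_rpow]
  field_simp
  ring
end
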